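/- Let μ : [1,∞) → (0,∞) be a nonincreasing function with ∫_1^∞ μ(s) ds < ∞, and suppose that liminf_{t→∞} (log(1/μ(t)))/(log t) = 1. Define S(t) = ∫_t^∞ μ(s) ds for t ≥ 1. Then limsup_{t→∞} S(2t)/S(t) = 1. -/

import Mathlib

open Filter MeasureTheory Set Topology

theorem liminf_order_one_at_infty_of_integrable_implies_limsup_ratio_one
    (μ S : ℝ → ℝ)
    (hpos : ∀ t : ℝ, 1 ≤ t → 0 < μ t)
    (hmono : ∀ s t : ℝ, 1 ≤ s → s ≤ t → μ t ≤ μ s)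
    (hint : IntegrableOn μ (Set.Ici (1:ℝ)) volume)
    (hord : Filter.liminf (fun t => Real.log (1 / μ t) / Real.log t) Filter.atTop = 1)
    (hS : ∀ t : ℝ, 1 ≤ t → S t = ∫ s in Set.Ioi t, μ s) :
    Filter.limsup (fun t => S (2 * t) / S t) Filter.atTop = 1 := by
  have hI : ∀ t : ℝ, 1 ≤ t → IntegrableOn μ (Set.Ioi t) volume := fun t ht =>
    hint.mono_set (fun x hx => le_trans ht (le_of_lt hx))
  have hanti : ∀ s t : ℝ, 1 ≤ s → s ≤ t → S t ≤ S s := by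
    intro s t hs hst
    rw [hS s hs, hS t (hs.trans hst)]
    apply setIntegral_mono_set (hI s hs)
    · filter_upwards [ae_restrict_mem measurableSet_Ioi] with x hx
      exact (hpos x (hs.trans (le_of_lt hx))).le
    · exact (Ioi_subset_Ioi hst).eventuallyLE
  have hlow : ∀ t : ℝ, 1 ≤ t → t * μ (2 * t) ≤ S t := by
    intro t ht
    rw [hS t ht]
    have h1 : ∫ s in Set.Ioc t (2*t), μ (2*t) ≤ ∫ s in Set.Ioc t (2*t), μ s := by
      apply setIntegral_mono_on
      · exact integrableOn_const (by simp)
      · exact (hI t ht).mono_set Ioc_subset_Ioi_self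
      · exact measurableSet_Ioc
      · intro x hx
        exact hmono _ _ (ht.trans hx.1.le) hx.2
    have h2 : ∫ s in Set.Ioc t (2*t), μ s ≤ ∫ s in Set.Ioi t, μ s := by
      apply setIntegral_mono_set (hI t ht)
      · filter_upwards [ae_restrict_mem measurableSet_Ioi] with x hx
        exact (hpos x (ht.trans (le_of_lt hx))).le
      · exact (Ioc_subset_Ioi_self).eventuallyLE
    have h3 : ∫ s in Set.Ioc t (2*t), μ (2*t) = t * μ (2*t) := by
      rw [setIntegral_const, smul_eq_mul, Real.volume_real_Ioc_of_le (by linarith)]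
      ring
    linarith
  have hSpos : ∀ t : ℝ, 1 ≤ t → 0 < S t := fun t ht =>
    lt_of_lt_of_le (mul_pos (by linarith) (hpos _ (by linarith))) (hlow t ht)
  have hle1 : ∀ᶠ t in atTop, S (2*t) / S t ≤ 1 := by
    filter_upwards [eventually_ge_atTop 1] with t ht
    rw [div_le_one (hSpos t ht)]
    exact hanti _ _ ht (by linarith)
  have hge0 : ∀ᶠ t in atTop, 0 ≤ S (2*t) / S t := by
    filter_upwards [eventually_ge_atTop 1] with t ht
    exact (div_pos (hSpos _ (by linarith)) (hSpos t ht)).le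
  have hbd : IsBoundedUnder (· ≤ ·) atTop (fun t => S (2*t) / S t) := ⟨1, by simpa using hle1⟩
  have hbd' : IsBoundedUnder (· ≥ ·) atTop (fun t => S (2*t) / S t) := ⟨0, by simpa using hge0⟩
  apply le_antisymm
  · exact limsup_le_of_le hbd'.isCoboundedUnder_le hle1
  by_contra! hlt
  obtain ⟨c, hc, hc1⟩ := exists_between (max_lt hlt one_pos)
  have hc0 : 0 < c := lt_of_le_of_lt (le_max_right _ _) hc
  have hev := eventually_lt_of_limsup_lt (lt_of_le_of_lt (le_max_left _ _) hc) hbd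
  obtain ⟨T₀, hT₀⟩ := eventually_atTop.1 hev
  set T := max T₀ 1 with hT
  have hT1 : 1 ≤ T := le_max_right _ _
  have hstep : ∀ t, T ≤ t → S (2*t) ≤ c * S t := by
    intro t ht
    have := hT₀ t ((le_max_left _ _).trans ht)
    exact ((div_lt_iff₀ (hSpos t (hT1.trans ht))).1 this).le
  -- logarithmic form
  have hl2 : 0 < Real.log 2 := Real.log_pos (by norm_num)
  set a := - Real.log c / Real.log 2 with ha
  have ha0 : 0 < a := div_pos (by have := Real.log_neg hc0 hc1; linarith) hl2
  have hac : a * Real.log 2 = - Real.log c := by rw [ha]; field_simp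
  have hind : ∀ n : ℕ, ∀ t, T ≤ t → t ≤ 2^n * T →
      Real.log (S t) + a * Real.log t ≤ Real.log (S T) + a * Real.log (2 * T) := by
    have base : ∀ t, T ≤ t → t ≤ 2 * T →
      Real.log (S t) + a * Real.log t ≤ Real.log (S T) + a * Real.log (2 * T) := by
      intro t ht ht2
      have h1 := Real.log_le_log (hSpos t (hT1.trans ht)) (hanti T t hT1 ht)
      have h2 := Real.log_le_log (by linarith : 0 < t) ht2
      have := mul_le_mul_of_nonneg_left h2 ha0.le
      linarith
    intro n
    induction n with
    | zero => intro t ht ht2; exact base t ht (by simp at ht2; linarith)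
    | succ n ih =>
      intro t ht ht2
      rcases le_total t (2*T) with h | h
      · exact base t ht h
      have h3 := ih (t/2) (by linarith) (by rw [pow_succ] at ht2; linarith)
      have h4 := hstep (t/2) (by linarith)
      rw [mul_div_cancel₀ t (by norm_num : (2:ℝ) ≠ 0)] at h4
      have hp := hSpos (t/2) (by linarith)
      have h5 := Real.log_le_log (hSpos t (hT1.trans ht)) h4
      rw [Real.log_mul hc0.ne' hp.ne'] at h5
      rw [Real.log_div (by linarith) (by norm_num)] at h3
      linarith
  set K := Real.log (S T) + a * Real.log (2 * T) with hK
  have hall : ∀ t, T ≤ t → Real.log (S t) + a * Real.log t ≤ K := by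
    intro t ht
    obtain ⟨n, hn⟩ := pow_unbounded_of_one_lt t (by norm_num : (1:ℝ) < 2)
    refine hind n t ht (hn.le.trans ?_)
    exact le_mul_of_one_le_right (by positivity) hT1
  set K' := K + (1 + a) * Real.log 2 with hK'
  have hfin : ∀ᶠ u in atTop, 1 + a/2 ≤ Real.log (1 / μ u) / Real.log u := by
    filter_upwards [eventually_ge_atTop (2*T), Real.tendsto_log_atTop.eventually_ge_atTop (K' / (a/2)),
      Real.tendsto_log_atTop.eventually_gt_atTop 0] with u hu hu2 hu0
    rw [le_div_iff₀ hu0, one_div, Real.log_inv]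
    have h1 := hall (u/2) (by linarith)
    have h2 := hlow (u/2) (by linarith)
    rw [mul_div_cancel₀ u (by norm_num : (2:ℝ) ≠ 0)] at h2
    have hm := hpos u (by linarith)
    have h3 := Real.log_le_log (mul_pos (by linarith) hm) h2
    rw [Real.log_mul (by linarith) hm.ne'] at h3
    rw [Real.log_div (by linarith) (by norm_num)] at h1 h3
    rw [div_le_iff₀ (by linarith)] at hu2
    linarith
  rw [liminf_eq] at hord
  have hb : BddAbove {b | ∀ᶠ u in atTop, b ≤ Real.log (1 / μ u) / Real.log u} := by
    by_contra h
    rw [Real.sSup_of_not_bddAbove h] at hord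
    norm_num at hord
  have := le_csSup hb hfin
  linarith
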